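/- Let d ≥ 2 be an integer, let p_1, …, p_d be nonnegative reals with ∑_{i=1}^{d} p_i ≤ 1 and p_i ≥ 1.55·p_{i−1} for all 2 ≤ i ≤ d−1, and let λ > 0. Then p_1 · λ_1(λ) · ∑_{i=1}^{d} i·p_i·q_{i+1,i+1}(λ) ≤ 0.55·d·(d+1)/(1.55^{d−1} − 1). -/

import Mathlib

open Filter Real

/-- `fTail ℓ x = e^x − ∑_{i=0}^{ℓ−1} x^i/i!`. -/
noncomputable def fTail (ℓ : ℕ) (x : ℝ) : ℝ :=
  Real.exp x - ∑ i ∈ Finset.range ℓ, x ^ i / (Nat.factorial i : ℝ)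

/-- `truncMean ℓ x` is the mean of a Poisson(x) random variable conditioned on
being at least `ℓ`. -/
noncomputable def truncMean (ℓ : ℕ) (x : ℝ) : ℝ :=
  (∑' i : ℕ, if ℓ ≤ i then (i : ℝ) * x ^ i / (Nat.factorial i : ℝ) else 0) /
  (∑' i : ℕ, if ℓ ≤ i then x ^ i / (Nat.factorial i : ℝ) else 0)

/-- `q ℓ r x = r·Pr(Po_{≥ℓ}(x) = r)/λ_ℓ(x)` for `r ≥ ℓ`, and `0` otherwise. -/
noncomputable def qProb (ℓ r : ℕ) (x : ℝ) : ℝ :=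
  if ℓ ≤ r then (r : ℝ) * (x ^ r / ((Nat.factorial r : ℝ) * fTail ℓ x)) / truncMean ℓ x
  else 0

theorem hasSum_fTail (ℓ : ℕ) (x : ℝ) :
    HasSum (fun i : ℕ => if ℓ ≤ i then x ^ i / (Nat.factorial i : ℝ) else 0) (fTail ℓ x) := by
  have hexp : HasSum (fun i : ℕ => x ^ i / (Nat.factorial i : ℝ)) (Real.exp x) := by
    rw [Real.exp_eq_exp_ℝ]
    exact NormedSpace.expSeries_div_hasSum_exp x
  have hfin : HasSum (fun i : ℕ => if i < ℓ then x ^ i / (Nat.factorial i : ℝ) else 0)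
      (∑ i ∈ Finset.range ℓ, x ^ i / (Nat.factorial i : ℝ)) := by
    rw [← Finset.sum_congr rfl fun i hi => if_pos (Finset.mem_range.mp hi)]
    exact hasSum_sum_of_ne_finset_zero fun i hi => if_neg (by simpa using hi)
  rw [fTail]
  convert! hexp.sub hfin using 2 with i
  by_cases h : i < ℓ
  · simp [h]
  · simp [h, not_lt.mp h]

theorem truncMean_succ (m : ℕ) (x : ℝ) :
    truncMean (m + 1) x = x * fTail m x / fTail (m + 1) x := by
  have hnum : HasSum
      (fun i : ℕ => if m + 1 ≤ i then (i : ℝ) * x ^ i / (Nat.factorial i : ℝ) else 0)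
      (x * fTail m x) := by
    rw [← hasSum_nat_add_iff' 1, Finset.sum_range_one, if_neg (by omega), sub_zero]
    convert! (hasSum_fTail m x).mul_left x using 2 with i
    by_cases h : m ≤ i
    · simp only [add_le_add_iff_right, h, if_true, Nat.factorial_succ, Nat.cast_mul, pow_succ]
      have : ((i + 1 : ℕ) : ℝ) ≠ 0 := by positivity
      field_simp
    · simp [h]
  rw [truncMean, hnum.tsum_eq, (hasSum_fTail (m + 1) x).tsum_eq]

theorem add_le_fTail (m : ℕ) {x : ℝ} (hx : 0 ≤ x) :
    x ^ m / (Nat.factorial m : ℝ) + x ^ (m + 1) / (Nat.factorial (m + 1) : ℝ) ≤ fTail m x := by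
  have h := Real.sum_le_exp_of_nonneg hx (m + 2)
  rw [Finset.sum_range_succ, Finset.sum_range_succ] at h
  rw [fTail]
  linarith

theorem fTail_pos (m : ℕ) {x : ℝ} (hx : 0 < x) : 0 < fTail m x :=
  lt_of_lt_of_le (by positivity) (add_le_fTail m hx.le)

theorem qProb_succ_self (m : ℕ) {x : ℝ} (hx : 0 < x) :
    qProb (m + 1) (m + 1) x = x ^ m / ((Nat.factorial m : ℝ) * fTail m x) := by
  have h0 := (fTail_pos m hx).ne'
  have h1 := (fTail_pos (m + 1) hx).ne'
  have hm : ((m + 1 : ℕ) : ℝ) ≠ 0 := by positivity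
  rw [qProb, if_pos le_rfl, truncMean_succ, Nat.factorial_succ, Nat.cast_mul, pow_succ]
  field_simp

theorem qProb_succ_self_nonneg (m : ℕ) {x : ℝ} (hx : 0 < x) :
    0 ≤ qProb (m + 1) (m + 1) x := by
  have h0 := fTail_pos m hx
  rw [qProb_succ_self m hx]
  positivity

theorem qProb_succ_self_le (m : ℕ) {x : ℝ} (hx : 0 < x) :
    qProb (m + 1) (m + 1) x ≤ (m + 1) / (m + 1 + x) := by
  have h0 := fTail_pos m hx
  rw [qProb_succ_self m hx, div_le_div_iff₀ (by positivity) (by positivity)]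
  calc x ^ m * (m + 1 + x)
      = (m + 1) * (Nat.factorial m : ℝ) *
          (x ^ m / (Nat.factorial m : ℝ) + x ^ (m + 1) / (Nat.factorial (m + 1) : ℝ)) := by
        rw [Nat.factorial_succ]
        push_cast
        field_simp
        ring
    _ ≤ (m + 1) * (Nat.factorial m : ℝ) * fTail m x := by
        gcongr
        exact add_le_fTail m hx.le
    _ = (m + 1) * ((Nat.factorial m : ℝ) * fTail m x) := by ring

theorem truncMean_one_nonneg {x : ℝ} (hx : 0 < x) : 0 ≤ truncMean 1 x := by
  have h0 := fTail_pos 0 hx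
  have h1 := fTail_pos 1 hx
  rw [truncMean_succ 0]
  positivity

theorem truncMean_one_le {x : ℝ} (hx : 0 < x) : truncMean 1 x ≤ 1 + x := by
  have h1 := fTail_pos 1 hx
  rw [truncMean_succ 0, div_le_iff₀ h1]
  simp only [fTail, Finset.sum_range_zero, Finset.sum_range_one, sub_zero, pow_zero,
    Nat.factorial_zero, Nat.cast_one, div_one]
  linarith [Real.add_one_le_exp x]

theorem truncMean_one_mul_qProb_le (m : ℕ) {x : ℝ} (hx : 0 < x) :
    truncMean 1 x * qProb (m + 1) (m + 1) x ≤ m + 1 := by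
  calc truncMean 1 x * qProb (m + 1) (m + 1) x
      ≤ (1 + x) * ((m + 1) / (m + 1 + x)) :=
        mul_le_mul (truncMean_one_le hx) (qProb_succ_self_le m hx)
          (qProb_succ_self_nonneg m hx) (by positivity)
    _ ≤ m + 1 := by
        rw [mul_div_assoc', div_le_iff₀ (by positivity)]
        have hm : (0 : ℝ) ≤ m := m.cast_nonneg
        nlinarith [mul_nonneg hm (by positivity : (0 : ℝ) ≤ m + 1)]

theorem mul_geom_sum_le_sum_Icc {p : ℕ → ℝ} {r : ℝ} (hr : 0 ≤ r) (n : ℕ)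
    (hp : ∀ i, 2 ≤ i → i ≤ n → r * p (i - 1) ≤ p i) :
    p 1 * ∑ i ∈ Finset.range n, r ^ i ≤ ∑ i ∈ Finset.Icc 1 n, p i := by
  have hpow : ∀ i, i < n → p 1 * r ^ i ≤ p (i + 1) := by
    intro i
    induction i with
    | zero => simp
    | succ i ih =>
      intro hi
      calc p 1 * r ^ (i + 1) = r * (p 1 * r ^ i) := by ring
        _ ≤ r * p (i + 1) := mul_le_mul_of_nonneg_left (ih (by omega)) hr
        _ ≤ p (i + 1 + 1) := hp (i + 1 + 1) (by omega) (by omega)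
  rw [Finset.mul_sum, Finset.range_eq_Ico, ← Finset.Ico_add_one_right_eq_Icc,
    ← Finset.sum_Ico_add' p 0 n 1]
  exact Finset.sum_le_sum fun i hi => hpow i (Finset.mem_Ico.mp hi).2

/-- Let `d ≥ 2`, let `p_1, …, p_d` be nonnegative reals with `∑_{i=1}^d p_i ≤ 1` and
`p_i ≥ 1.55·p_{i−1}` for `2 ≤ i ≤ d−1`, and let `λ > 0`.  Then
`p_1·λ_1(λ)·∑_{i=1}^d i·p_i·q_{i+1,i+1}(λ) ≤ 0.55·d·(d+1)/(1.55^{d−1} − 1)`. -/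
theorem stmt_16 (d : ℕ) (hd : 2 ≤ d) (p : ℕ → ℝ)
    (hnonneg : ∀ i, 1 ≤ i → i ≤ d → 0 ≤ p i)
    (hsum : ∑ i ∈ Finset.Icc 1 d, p i ≤ 1)
    (hgeo : ∀ i, 2 ≤ i → i ≤ d - 1 → 1.55 * p (i - 1) ≤ p i)
    (l : ℝ) (hl : 0 < l) :
    p 1 * truncMean 1 l * ∑ i ∈ Finset.Icc 1 d, (i : ℝ) * p i * qProb (i + 1) (i + 1) l ≤
      0.55 * d * (d + 1) / ((1.55 : ℝ) ^ (d - 1) - 1) := by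
  have hmean := truncMean_one_nonneg hl
  have hp1 : 0 ≤ p 1 := hnonneg 1 le_rfl (by omega)
  have hden : (0 : ℝ) < (1.55 : ℝ) ^ (d - 1) - 1 :=
    sub_pos.mpr (one_lt_pow₀ (by norm_num) (by omega))
  have hweighted : truncMean 1 l * ∑ i ∈ Finset.Icc 1 d, (i : ℝ) * p i * qProb (i + 1) (i + 1) l
      ≤ d * (d + 1) := by
    calc truncMean 1 l * ∑ i ∈ Finset.Icc 1 d, (i : ℝ) * p i * qProb (i + 1) (i + 1) l
        ≤ ∑ i ∈ Finset.Icc 1 d, (d * (d + 1) : ℝ) * p i := by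
          rw [Finset.mul_sum]
          refine Finset.sum_le_sum fun i hi => ?_
          obtain ⟨hi1, hid⟩ := Finset.mem_Icc.mp hi
          have hpi := hnonneg i hi1 hid
          have hid' : (i : ℝ) ≤ d := by exact_mod_cast hid
          calc truncMean 1 l * ((i : ℝ) * p i * qProb (i + 1) (i + 1) l)
              = i * (truncMean 1 l * qProb (i + 1) (i + 1) l) * p i := by ring
            _ ≤ i * (i + 1) * p i := by
                gcongr
                exact truncMean_one_mul_qProb_le i hl
            _ ≤ d * (d + 1) * p i := by gcongr
      _ = d * (d + 1) * ∑ i ∈ Finset.Icc 1 d, p i := by rw [Finset.mul_sum]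
      _ ≤ d * (d + 1) := mul_le_of_le_one_right (by positivity) hsum
  have hfirst : p 1 ≤ 0.55 / ((1.55 : ℝ) ^ (d - 1) - 1) := by
    have hgeom := mul_geom_sum_le_sum_Icc (by norm_num : (0 : ℝ) ≤ 1.55) (d - 1) hgeo
    have hmono : ∑ i ∈ Finset.Icc 1 (d - 1), p i ≤ ∑ i ∈ Finset.Icc 1 d, p i :=
      Finset.sum_le_sum_of_subset_of_nonneg (Finset.Icc_subset_Icc_right (by omega))
        fun i hi _ => hnonneg i (Finset.mem_Icc.mp hi).1 (Finset.mem_Icc.mp hi).2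
    have hmul := geom_sum_mul (1.55 : ℝ) (d - 1)
    rw [le_div_iff₀ hden, ← hmul]
    norm_num at hgeom hmono hsum ⊢
    linarith
  calc p 1 * truncMean 1 l * ∑ i ∈ Finset.Icc 1 d, (i : ℝ) * p i * qProb (i + 1) (i + 1) l
      = p 1 * (truncMean 1 l *
          ∑ i ∈ Finset.Icc 1 d, (i : ℝ) * p i * qProb (i + 1) (i + 1) l) := mul_assoc _ _ _
    _ ≤ p 1 * (d * (d + 1)) := mul_le_mul_of_nonneg_left hweighted hp1
    _ ≤ 0.55 / ((1.55 : ℝ) ^ (d - 1) - 1) * (d * (d + 1)) := by gcongr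
    _ = 0.55 * d * (d + 1) / ((1.55 : ℝ) ^ (d - 1) - 1) := by ring
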